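/- For every l ∈ {0,…,N−1} and every θ ∈ θ_p, the spin operator s_l satisfies the conjugation formulas s_l·φ†_θ·s_l = ∑_{θ'∈θ_a} (A_{θ,θ'}·ψ†_{θ'} + B_{θ,θ'}·ψ_{θ'}) and s_l·φ_θ·s_l = ∑_{θ'∈θ_a} (C_{θ,θ'}·ψ†_{θ'} + D_{θ,θ'}·ψ_{θ'}), where D_{θ,θ'} = e^{−i(l−1/2)(θ−θ')}/(2iN·sin((θ'−θ)/2)) · (√(b_{θ'})/√(b_θ) + √(b_θ)/√(b_{θ'})), C_{θ,θ'} = e^{−i(l−1/2)(θ+θ')}/(2iN·sin((θ+θ')/2)) · (√(b_θ)√(b_{θ'}) − 1/(√(b_θ)√(b_{θ'}))), and A, B are the entrywise complex conjugates of D, C respectively. (Here s_l² = 1, so s_l = s_l^{−1}.) -/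

import Mathlib

open Finset Matrix

noncomputable section

/-- Pauli matrix σ_x. -/
def pauliX : Matrix (Fin 2) (Fin 2) ℂ := !![0, 1; 1, 0]

/-- Pauli matrix σ_y. -/
def pauliY : Matrix (Fin 2) (Fin 2) ℂ := !![0, -Complex.I; Complex.I, 0]

/-- Pauli matrix σ_z. -/
def pauliZ : Matrix (Fin 2) (Fin 2) ℂ := !![1, 0; 0, -1]

/-- Operators on (ℂ²)^{⊗N} ≅ ℂ^{2^N}, realized as matrices indexed by spin configurations. -/
abbrev SpinOp (N : ℕ) := Matrix (Fin N → Fin 2) (Fin N → Fin 2) ℂ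

/-- Tensor product w_0 ⊗ w_1 ⊗ ⋯ ⊗ w_{N−1} of one-site matrices. -/
def tensorOp {N : ℕ} (w : Fin N → Matrix (Fin 2) (Fin 2) ℂ) : SpinOp N :=
  Matrix.of fun a b => ∏ k : Fin N, w k (a k) (b k)

/-- s_j = 1^{⊗j} ⊗ σ_z ⊗ 1^{⊗(N−1−j)}. -/
def sOp {N : ℕ} (j : Fin N) : SpinOp N :=
  tensorOp fun k => if k = j then pauliZ else 1

/-- C_j = 1^{⊗j} ⊗ σ_x ⊗ 1^{⊗(N−1−j)}. -/
def COp {N : ℕ} (j : Fin N) : SpinOp N :=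
  tensorOp fun k => if k = j then pauliX else 1

/-- p_j = σ_x^{⊗j} ⊗ σ_z ⊗ 1^{⊗(N−1−j)}. -/
def pOp {N : ℕ} (j : Fin N) : SpinOp N :=
  tensorOp fun k => if k < j then pauliX else if k = j then pauliZ else 1

/-- q_j = σ_x^{⊗j} ⊗ σ_y ⊗ 1^{⊗(N−1−j)}. -/
def qOp {N : ℕ} (j : Fin N) : SpinOp N :=
  tensorOp fun k => if k < j then pauliX else if k = j then pauliY else 1

/-- Antiperiodic momenta: θ_a = {(2j−1)π/N : j = 1,…,N}. -/
def thetaA (N : ℕ) (j : Fin N) : ℝ := (2 * (j : ℝ) + 1) * Real.pi / N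

/-- Periodic momenta: θ_p = {2(j−1)π/N : j = 1,…,N}. -/
def thetaP (N : ℕ) (j : Fin N) : ℝ := (2 * (j : ℝ)) * Real.pi / N

/-- b_θ, the principal square root of
`(1−αe^{iθ})(1−βe^{−iθ}) / ((1−βe^{iθ})(1−αe^{−iθ}))`. -/
def bfun (α β θ : ℝ) : ℂ :=
  ((((1 : ℂ) - (α : ℂ) * Complex.exp (Complex.I * θ)) *
      ((1 : ℂ) - (β : ℂ) * Complex.exp (-Complex.I * θ))) /
    (((1 : ℂ) - (β : ℂ) * Complex.exp (Complex.I * θ)) *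
      ((1 : ℂ) - (α : ℂ) * Complex.exp (-Complex.I * θ)))) ^ ((2 : ℂ)⁻¹)

/-- √(b_θ), principal square root. -/
def sqb (α β θ : ℝ) : ℂ := bfun α β θ ^ ((2 : ℂ)⁻¹)

/-- Discrete Fourier transform p_θ = N^{−1/2} ∑_j e^{−ijθ} p_j. -/
def pF {N : ℕ} (θ : ℝ) : SpinOp N :=
  (((Real.sqrt N : ℝ) : ℂ))⁻¹ • ∑ j : Fin N, Complex.exp (-Complex.I * (j : ℂ) * θ) • pOp j

/-- Discrete Fourier transform q_θ = N^{−1/2} ∑_j e^{−ijθ} q_j. -/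
def qF {N : ℕ} (θ : ℝ) : SpinOp N :=
  (((Real.sqrt N : ℝ) : ℂ))⁻¹ • ∑ j : Fin N, Complex.exp (-Complex.I * (j : ℂ) * θ) • qOp j

/-- Creation operator 2ψ†_θ = e^{−iθ}√(b_θ)·p_{−θ} − i√(b_{−θ})·q_{−θ}
(with −θ understood as 2π−θ; since p_θ, q_θ and b_θ are 2π-periodic in θ,
we may use −θ directly). -/
def psiDag {N : ℕ} (α β : ℝ) (θ : ℝ) : SpinOp N :=
  (2 : ℂ)⁻¹ • ((Complex.exp (-Complex.I * θ) * sqb α β θ) • pF (-θ) -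
    (Complex.I * sqb α β (-θ)) • qF (-θ))

/-- Annihilation operator 2ψ_θ = e^{iθ}√(b_{−θ})·p_θ + i√(b_θ)·q_θ. -/
def psiAnn {N : ℕ} (α β : ℝ) (θ : ℝ) : SpinOp N :=
  (2 : ℂ)⁻¹ • ((Complex.exp (Complex.I * θ) * sqb α β (-θ)) • pF θ +
    (Complex.I * sqb α β θ) • qF θ)

/-- The matrix D, rows indexed by θ ∈ θ_p, columns by θ' ∈ θ_a. -/
def Dmat (N : ℕ) (l : ℤ) (α β : ℝ) : Matrix (Fin N) (Fin N) ℂ :=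
  Matrix.of fun j k =>
    Complex.exp (-Complex.I * ((l : ℂ) - 2⁻¹) * ((thetaP N j : ℝ) - (thetaA N k : ℝ))) /
        (2 * Complex.I * N * Complex.sin ((((thetaA N k : ℝ) : ℂ) - (thetaP N j : ℝ)) / 2)) *
      (sqb α β (thetaA N k) / sqb α β (thetaP N j) +
        sqb α β (thetaP N j) / sqb α β (thetaA N k))

/-- The matrix C, rows indexed by θ ∈ θ_p, columns by θ' ∈ θ_a. -/
def Cmat (N : ℕ) (l : ℤ) (α β : ℝ) : Matrix (Fin N) (Fin N) ℂ :=
  Matrix.of fun j k =>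
    Complex.exp (-Complex.I * ((l : ℂ) - 2⁻¹) * ((thetaP N j : ℝ) + (thetaA N k : ℝ))) /
        (2 * Complex.I * N * Complex.sin ((((thetaP N j : ℝ) : ℂ) + (thetaA N k : ℝ)) / 2)) *
      (sqb α β (thetaP N j) * sqb α β (thetaA N k) -
        1 / (sqb α β (thetaP N j) * sqb α β (thetaA N k)))

lemma tensorOp_mul {N : ℕ} (v w : Fin N → Matrix (Fin 2) (Fin 2) ℂ) :
    tensorOp v * tensorOp w = tensorOp fun k => v k * w k := by
  ext a b
  simp only [tensorOp, Matrix.mul_apply, Matrix.of_apply, ← Finset.prod_mul_distrib]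
  rw [Finset.prod_univ_sum, Fintype.piFinset_univ]

lemma tensorOp_smul {N : ℕ} (c : Fin N → ℂ) (w : Fin N → Matrix (Fin 2) (Fin 2) ℂ) :
    tensorOp (fun k => c k • w k) = (∏ k, c k) • tensorOp w := by
  ext a b
  simp [tensorOp, Finset.prod_mul_distrib]

lemma tensorOp_conjTranspose {N : ℕ} (w : Fin N → Matrix (Fin 2) (Fin 2) ℂ) :
    (tensorOp w)ᴴ = tensorOp fun k => (w k)ᴴ := by
  ext a b
  simp [tensorOp, Matrix.conjTranspose_apply]

lemma pauliX_conjTranspose : pauliXᴴ = pauliX := by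
  ext a b; fin_cases a <;> fin_cases b <;> simp [pauliX]

lemma pauliY_conjTranspose : pauliYᴴ = pauliY := by
  ext a b; fin_cases a <;> fin_cases b <;> simp [pauliY]

lemma pauliZ_conjTranspose : pauliZᴴ = pauliZ := by
  ext a b; fin_cases a <;> fin_cases b <;> simp [pauliZ]

lemma pauliZ_mul_self : pauliZ * pauliZ = 1 := by
  ext a b; fin_cases a <;> fin_cases b <;> simp [pauliZ]

lemma pauliZ_conj_pauliX : pauliZ * pauliX * pauliZ = -pauliX := by
  ext a b; fin_cases a <;> fin_cases b <;> simp [pauliZ, pauliX]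

lemma pauliZ_conj_pauliY : pauliZ * pauliY * pauliZ = -pauliY := by
  ext a b; fin_cases a <;> fin_cases b <;> simp [pauliZ, pauliY]

lemma sOp_conjTranspose {N : ℕ} (j : Fin N) : (sOp j)ᴴ = sOp j := by
  simp only [sOp, tensorOp_conjTranspose]
  congr 1; ext1 k
  split_ifs <;> simp [pauliZ_conjTranspose]

lemma pOp_conjTranspose {N : ℕ} (j : Fin N) : (pOp j)ᴴ = pOp j := by
  simp only [pOp, tensorOp_conjTranspose]
  congr 1; ext1 k
  split_ifs <;> simp [pauliX_conjTranspose, pauliZ_conjTranspose]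

lemma qOp_conjTranspose {N : ℕ} (j : Fin N) : (qOp j)ᴴ = qOp j := by
  simp only [qOp, tensorOp_conjTranspose]
  congr 1; ext1 k
  split_ifs <;> simp [pauliX_conjTranspose, pauliY_conjTranspose]

/-- Conjugation by `sOp l` only affects the tensor factor at site `l`. -/
lemma sOp_conj_tensorOp {N : ℕ} (l : Fin N) (w : Fin N → Matrix (Fin 2) (Fin 2) ℂ) (ε : ℂ)
    (h : pauliZ * w l * pauliZ = ε • w l) :
    sOp l * tensorOp w * sOp l = ε • tensorOp w := by
  have hw : (fun k => (if k = l then pauliZ else 1) * w k * (if k = l then pauliZ else 1)) =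
      fun k => (if k = l then ε else 1) • w k := by
    ext1 k
    by_cases hk : k = l
    · subst hk; simpa using h
    · simp [hk]
  rw [sOp, tensorOp_mul, tensorOp_mul, hw, tensorOp_smul]
  simp

lemma sOp_conj_pOp {N : ℕ} (l j : Fin N) :
    sOp l * pOp j * sOp l = (if (j : ℕ) < (l : ℕ) + 1 then (1 : ℂ) else -1) • pOp j := by
  refine sOp_conj_tensorOp l _ _ ?_
  rcases lt_trichotomy l j with h | rfl | h
  · have h' : ¬ (j : ℕ) < (l : ℕ) + 1 := by have := Fin.lt_def.mp h; omega
    simp [h, h', pauliZ_conj_pauliX]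
  · simp [pauliZ_mul_self]
  · have h' : (j : ℕ) < (l : ℕ) + 1 := by have := Fin.lt_def.mp h; omega
    simp [h.not_gt, h.ne', h', pauliZ_mul_self]

lemma sOp_conj_qOp {N : ℕ} (l j : Fin N) :
    sOp l * qOp j * sOp l = (if (j : ℕ) < (l : ℕ) then (1 : ℂ) else -1) • qOp j := by
  refine sOp_conj_tensorOp l _ _ ?_
  rcases lt_trichotomy l j with h | rfl | h
  · have h' : ¬ (j : ℕ) < (l : ℕ) := by have := Fin.lt_def.mp h; omega
    simp [h, h', pauliZ_conj_pauliX]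
  · simp [pauliZ_conj_pauliY]
  · have h' : (j : ℕ) < (l : ℕ) := Fin.lt_def.mp h
    simp [h.not_gt, h.ne', h', pauliZ_mul_self]

lemma exp_thetaA_sub_thetaP_pow {N : ℕ} (j k : Fin N) :
    Complex.exp (Complex.I * ((thetaA N k : ℝ) - (thetaP N j : ℝ))) ^ N = -1 := by
  have hN : (N : ℂ) ≠ 0 := by exact_mod_cast (Fin.pos j).ne'
  have h : (N : ℂ) * (Complex.I * ((thetaA N k : ℝ) - (thetaP N j : ℝ))) =
      ((k : ℤ) - (j : ℤ) : ℤ) * (2 * Real.pi * Complex.I) + Real.pi * Complex.I := by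
    simp only [thetaA, thetaP]
    push_cast
    field_simp
    ring
  rw [← Complex.exp_nat_mul, h, Complex.exp_add, Complex.exp_int_mul_two_pi_mul_I,
    Complex.exp_pi_mul_I, one_mul]

lemma exp_thetaA_sub_thetaP_ne_one {N : ℕ} (j k : Fin N) :
    Complex.exp (Complex.I * ((thetaA N k : ℝ) - (thetaP N j : ℝ))) ≠ 1 := by
  intro h
  have := exp_thetaA_sub_thetaP_pow j k
  rw [h, one_pow] at this
  norm_num at this

lemma two_I_mul_sin_half (z : ℂ) :
    2 * Complex.I * Complex.sin (z / 2) * Complex.exp (Complex.I * z / 2) =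
      Complex.exp (Complex.I * z) - 1 := by
  have h1 : Complex.exp (Complex.I * z) = Complex.exp (Complex.I * z / 2) ^ 2 := by
    rw [← Complex.exp_nat_mul]; congr 1; push_cast; ring
  have h2 : Complex.exp (-(z / 2) * Complex.I) * Complex.exp (Complex.I * z / 2) = 1 := by
    rw [← Complex.exp_add, Complex.exp_eq_one_iff]; exact ⟨0, by push_cast; ring⟩
  have h3 : Complex.exp (z / 2 * Complex.I) = Complex.exp (Complex.I * z / 2) := by
    congr 1; ring
  rw [Complex.sin, h3, h1]
  linear_combination h2 * Complex.I ^ 2 -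
    (Complex.exp (Complex.I * z / 2) ^ 2 - 1) * Complex.I_sq

lemma sin_half_thetaA_sub_thetaP_ne_zero {N : ℕ} (j k : Fin N) :
    Complex.sin ((((thetaA N k : ℝ) : ℂ) - (thetaP N j : ℝ)) / 2) ≠ 0 := by
  intro h
  have := two_I_mul_sin_half (((thetaA N k : ℝ) : ℂ) - (thetaP N j : ℝ))
  rw [h] at this
  apply exp_thetaA_sub_thetaP_ne_one j k
  linear_combination -this

/-- The antiperiodic Fourier coefficients of a periodic plane wave whose sign is flipped from
site `m` on. -/
def flipCoeff (N m : ℕ) (j k : Fin N) : ℂ :=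
  Complex.exp (Complex.I * ((m : ℂ) - 2⁻¹) * ((thetaA N k : ℝ) - (thetaP N j : ℝ))) /
    (Complex.I * N * Complex.sin ((((thetaA N k : ℝ) : ℂ) - (thetaP N j : ℝ)) / 2))

lemma sum_sign_mul_pow {N m : ℕ} (hm : m ≤ N) {x : ℂ} (hx : x ≠ 1) (hxN : x ^ N = -1) :
    ∑ i : Fin N, (if (i : ℕ) < m then (1 : ℂ) else -1) * x ^ (i : ℕ) = 2 * x ^ m / (x - 1) := by
  have hx' : x - 1 ≠ 0 := sub_ne_zero.mpr hx
  have h1 : ∀ i ∈ Finset.range m, (if i < m then (1 : ℂ) else -1) * x ^ i = x ^ i := by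
    intro i hi; simp [Finset.mem_range.mp hi]
  have h2 : ∀ i ∈ Finset.Ico m N, (if i < m then (1 : ℂ) else -1) * x ^ i = -x ^ i := by
    intro i hi; simp [(Finset.mem_Ico.mp hi).1]
  rw [Fin.sum_univ_eq_sum_range (fun i => (if i < m then (1 : ℂ) else -1) * x ^ i) N,
    ← Finset.sum_range_add_sum_Ico _ hm, Finset.sum_congr rfl h1, Finset.sum_congr rfl h2,
    Finset.sum_neg_distrib, geom_sum_eq hx, geom_sum_Ico hx hm, hxN]
  field_simp
  ring

lemma flipCoeff_eq_sum {N m : ℕ} (hm : m ≤ N) (j k : Fin N) :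
    flipCoeff N m j k = (N : ℂ)⁻¹ * ∑ i : Fin N, (if (i : ℕ) < m then (1 : ℂ) else -1) *
      Complex.exp (Complex.I * ((thetaA N k : ℝ) - (thetaP N j : ℝ))) ^ (i : ℕ) := by
  rw [sum_sign_mul_pow hm (exp_thetaA_sub_thetaP_ne_one j k) (exp_thetaA_sub_thetaP_pow j k),
    flipCoeff]
  have hs := sin_half_thetaA_sub_thetaP_ne_zero j k
  have hN : (N : ℂ) ≠ 0 := by exact_mod_cast (Fin.pos j).ne'
  generalize ((thetaA N k : ℝ) : ℂ) - (thetaP N j : ℝ) = z at *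
  rw [← two_I_mul_sin_half, ← Complex.exp_nat_mul,
    show Complex.I * ((m : ℂ) - 2⁻¹) * z = m * (Complex.I * z) - Complex.I * z / 2 by ring,
    Complex.exp_sub]
  have := Complex.I_ne_zero
  have := Complex.exp_ne_zero (Complex.I * z / 2)
  field_simp

lemma sum_exp_thetaA {N : ℕ} (i i' : Fin N) :
    ∑ k : Fin N, Complex.exp (Complex.I * ((i' : ℂ) - (i : ℂ)) * (thetaA N k : ℝ)) =
      if i' = i then (N : ℂ) else 0 := by
  have hN : (N : ℂ) ≠ 0 := by exact_mod_cast (Fin.pos i).ne'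
  split_ifs with h
  · simp [h]
  · set d : ℤ := (i' : ℤ) - (i : ℤ) with hd
    set x : ℂ := Complex.exp (2 * Real.pi * Complex.I * d / N) with hx
    have hterm : ∀ k : Fin N, Complex.exp (Complex.I * ((i' : ℂ) - (i : ℂ)) * (thetaA N k : ℝ)) =
        Complex.exp (Real.pi * Complex.I * d / N) * x ^ (k : ℕ) := by
      intro k
      rw [hx, ← Complex.exp_nat_mul, ← Complex.exp_add, hd, thetaA]
      congr 1
      push_cast
      field_simp
      ring
    have hxN : x ^ N = 1 := by
      rw [hx, ← Complex.exp_nat_mul, Complex.exp_eq_one_iff]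
      exact ⟨d, by field_simp⟩
    have hx1 : x ≠ 1 := by
      intro h1
      obtain ⟨n, hn⟩ := Complex.exp_eq_one_iff.mp h1
      have hdn : (d : ℂ) = n * N := by
        have h2 := Complex.two_pi_I_ne_zero
        field_simp at hn
        linear_combination hn
      have hdn' : d = n * N := by exact_mod_cast hdn
      have hlt : |d| < N := by rw [abs_lt]; omega
      have : d = 0 := Int.eq_zero_of_abs_lt_dvd ⟨n, by rw [hdn']; ring⟩ hlt
      exact h (Fin.ext (by omega))
    simp_rw [hterm]
    rw [← Finset.mul_sum, Fin.sum_univ_eq_sum_range (fun k => x ^ k) N, geom_sum_eq hx1, hxN]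
    simp

lemma sum_flipCoeff_mul_exp {N m : ℕ} (hm : m ≤ N) (j i : Fin N) :
    ∑ k : Fin N, flipCoeff N m j k * Complex.exp (-Complex.I * (i : ℂ) * (thetaA N k : ℝ)) =
      (if (i : ℕ) < m then (1 : ℂ) else -1) *
        Complex.exp (-Complex.I * (i : ℂ) * (thetaP N j : ℝ)) := by
  have hN : (N : ℂ) ≠ 0 := by exact_mod_cast (Fin.pos j).ne'
  have hterm : ∀ k : Fin N,
      flipCoeff N m j k * Complex.exp (-Complex.I * (i : ℂ) * (thetaA N k : ℝ)) =
      ∑ i' : Fin N, (N : ℂ)⁻¹ * ((if (i' : ℕ) < m then (1 : ℂ) else -1) *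
        Complex.exp (-Complex.I * (i' : ℂ) * (thetaP N j : ℝ))) *
        Complex.exp (Complex.I * ((i' : ℂ) - (i : ℂ)) * (thetaA N k : ℝ)) := by
    intro k
    rw [flipCoeff_eq_sum hm, Finset.mul_sum, Finset.sum_mul]
    refine Finset.sum_congr rfl fun i' _ => ?_
    have : Complex.exp (Complex.I * ((thetaA N k : ℝ) - (thetaP N j : ℝ))) ^ (i' : ℕ) *
        Complex.exp (-Complex.I * (i : ℂ) * (thetaA N k : ℝ)) =
        Complex.exp (-Complex.I * (i' : ℂ) * (thetaP N j : ℝ)) *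
        Complex.exp (Complex.I * ((i' : ℂ) - (i : ℂ)) * (thetaA N k : ℝ)) := by
      rw [← Complex.exp_nat_mul, ← Complex.exp_add, ← Complex.exp_add]
      congr 1
      ring
    linear_combination (N : ℂ)⁻¹ * (if (i' : ℕ) < m then (1 : ℂ) else -1) * this
  simp_rw [hterm]
  rw [Finset.sum_comm]
  simp_rw [← Finset.mul_sum, sum_exp_thetaA]
  simp
  field_simp

lemma sum_exp_smul_sign {N m : ℕ} (hm : m ≤ N) (j : Fin N) {M : Type*} [AddCommGroup M]
    [Module ℂ M] (f : Fin N → M) :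
    ∑ i : Fin N, Complex.exp (-Complex.I * (i : ℂ) * (thetaP N j : ℝ)) •
        (if (i : ℕ) < m then (1 : ℂ) else -1) • f i =
      ∑ k : Fin N, flipCoeff N m j k •
        ∑ i : Fin N, Complex.exp (-Complex.I * (i : ℂ) * (thetaA N k : ℝ)) • f i := by
  simp_rw [Finset.smul_sum, smul_smul]
  rw [Finset.sum_comm]
  refine Finset.sum_congr rfl fun i _ => ?_
  rw [← Finset.sum_smul, sum_flipCoeff_mul_exp hm, mul_comm]

lemma sOp_conj_pF {N : ℕ} (l j : Fin N) :
    sOp l * pF (thetaP N j) * sOp l =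
      ∑ k : Fin N, flipCoeff N (l + 1) j k • pF (thetaA N k) := by
  simp only [pF, mul_smul_comm, smul_mul_assoc, Finset.mul_sum, Finset.sum_mul, sOp_conj_pOp]
  rw [sum_exp_smul_sign l.isLt, Finset.smul_sum]
  exact Finset.sum_congr rfl fun k _ => smul_comm _ _ _

lemma sOp_conj_qF {N : ℕ} (l j : Fin N) :
    sOp l * qF (thetaP N j) * sOp l =
      ∑ k : Fin N, flipCoeff N l j k • qF (thetaA N k) := by
  simp only [qF, mul_smul_comm, smul_mul_assoc, Finset.mul_sum, Finset.sum_mul, sOp_conj_qOp]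
  rw [sum_exp_smul_sign l.isLt.le, Finset.smul_sum]
  exact Finset.sum_congr rfl fun k _ => smul_comm _ _ _

lemma flipCoeff_succ_mul_exp {N : ℕ} (m : ℕ) (j k : Fin N) :
    flipCoeff N (m + 1) j k * Complex.exp (Complex.I * (thetaP N j : ℝ)) =
      flipCoeff N m j k * Complex.exp (Complex.I * (thetaA N k : ℝ)) := by
  simp only [flipCoeff, div_mul_eq_mul_div, ← Complex.exp_add]
  congr 2
  push_cast
  ring

lemma pF_conjTranspose {N : ℕ} (θ : ℝ) : (pF θ : SpinOp N)ᴴ = pF (-θ) := by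
  simp only [pF, Matrix.conjTranspose_smul, Matrix.conjTranspose_sum, pOp_conjTranspose,
    star_inv₀, Complex.star_def, Complex.conj_ofReal, ← Complex.exp_conj]
  simp

lemma qF_conjTranspose {N : ℕ} (θ : ℝ) : (qF θ : SpinOp N)ᴴ = qF (-θ) := by
  simp only [qF, Matrix.conjTranspose_smul, Matrix.conjTranspose_sum, qOp_conjTranspose,
    star_inv₀, Complex.star_def, Complex.conj_ofReal, ← Complex.exp_conj]
  simp

lemma exp_nat_mul_add_two_pi (n : ℕ) (θ : ℝ) :
    Complex.exp (-Complex.I * (n : ℂ) * ((θ + 2 * Real.pi : ℝ) : ℂ)) =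
      Complex.exp (-Complex.I * (n : ℂ) * (θ : ℂ)) := by
  rw [Complex.exp_eq_exp_iff_exists_int]
  exact ⟨-n, by push_cast; ring⟩

lemma pF_add_two_pi {N : ℕ} (θ : ℝ) : (pF (θ + 2 * Real.pi) : SpinOp N) = pF θ := by
  simp only [pF, exp_nat_mul_add_two_pi]

lemma qF_add_two_pi {N : ℕ} (θ : ℝ) : (qF (θ + 2 * Real.pi) : SpinOp N) = qF θ := by
  simp only [qF, exp_nat_mul_add_two_pi]

lemma exp_I_mul_add_two_pi (θ : ℝ) :
    Complex.exp (Complex.I * ((θ + 2 * Real.pi : ℝ) : ℂ)) = Complex.exp (Complex.I * θ) := by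
  rw [Complex.exp_eq_exp_iff_exists_int]
  exact ⟨1, by push_cast; ring⟩

lemma exp_neg_I_mul_add_two_pi (θ : ℝ) :
    Complex.exp (-Complex.I * ((θ + 2 * Real.pi : ℝ) : ℂ)) = Complex.exp (-Complex.I * θ) := by
  simpa using exp_nat_mul_add_two_pi 1 θ

lemma sqb_add_two_pi (α β θ : ℝ) : sqb α β (θ + 2 * Real.pi) = sqb α β θ := by
  simp only [sqb, bfun, exp_I_mul_add_two_pi, exp_neg_I_mul_add_two_pi]

lemma psiDag_add_two_pi {N : ℕ} (α β θ : ℝ) :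
    (psiDag α β (θ + 2 * Real.pi) : SpinOp N) = psiDag α β θ := by
  have h : -θ = -(θ + 2 * Real.pi) + 2 * Real.pi := by ring
  rw [psiDag, psiDag, sqb_add_two_pi, exp_neg_I_mul_add_two_pi, h, sqb_add_two_pi,
    pF_add_two_pi, qF_add_two_pi]

/-- The quotient under the two square roots defining `sqb` avoids the branch cut. -/
lemma exists_bfun_eq {α β : ℝ} (hα : 0 ≤ α) (hα1 : α < 1) (hβ : 0 ≤ β) (hβ1 : β < 1) (θ : ℝ) :
    ∃ w : ℂ, 0 < w.re ∧ bfun α β θ = (w / (starRingEnd ℂ) w) ^ ((2 : ℂ)⁻¹) ∧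
      bfun α β (-θ) = ((starRingEnd ℂ) w / w) ^ ((2 : ℂ)⁻¹) := by
  have h1 : Complex.exp (Complex.I * θ) * Complex.exp (-Complex.I * θ) = 1 := by
    rw [← Complex.exp_add, Complex.exp_eq_one_iff]; exact ⟨0, by push_cast; ring⟩
  have hc : (starRingEnd ℂ) (Complex.exp (Complex.I * θ)) = Complex.exp (-Complex.I * θ) := by
    rw [← Complex.exp_conj]; simp
  have hc' : (starRingEnd ℂ) (Complex.exp (-Complex.I * θ)) = Complex.exp (Complex.I * θ) := by
    rw [← Complex.exp_conj]; simp
  refine ⟨(1 - (α : ℂ) * Complex.exp (Complex.I * θ)) *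
    (1 - (β : ℂ) * Complex.exp (-Complex.I * θ)), ?_, ?_, ?_⟩
  · have : (1 - (α : ℂ) * Complex.exp (Complex.I * θ)) *
        (1 - (β : ℂ) * Complex.exp (-Complex.I * θ)) = ((1 + α * β : ℝ) : ℂ) -
        (α : ℂ) * Complex.exp ((θ : ℝ) * Complex.I) -
        (β : ℂ) * Complex.exp ((-θ : ℝ) * Complex.I) := by
      rw [show ((θ : ℝ) : ℂ) * Complex.I = Complex.I * θ by ring,
        show ((-θ : ℝ) : ℂ) * Complex.I = -Complex.I * θ by push_cast; ring]
      push_cast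
      linear_combination (α : ℂ) * β * h1
    rw [this]
    simp only [Complex.sub_re, Complex.re_ofReal_mul, Complex.exp_ofReal_mul_I_re,
      Complex.ofReal_re, Real.cos_neg]
    nlinarith [Real.cos_le_one θ, mul_pos (sub_pos.mpr hα1) (sub_pos.mpr hβ1)]
  · simp only [bfun, map_mul, map_sub, map_one, Complex.conj_ofReal, hc, hc']
    rw [mul_comm (1 - (α : ℂ) * Complex.exp (-Complex.I * θ))]
  · simp only [bfun, map_mul, map_sub, map_one, Complex.conj_ofReal, hc, hc']
    push_cast
    simp only [mul_neg, neg_mul, neg_neg]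
    rw [mul_comm (1 - (β : ℂ) * Complex.exp (-(Complex.I * θ)))]

lemma div_conj_arg_ne_pi {w : ℂ} (hw : 0 < w.re) : (w / (starRingEnd ℂ) w).arg ≠ Real.pi := by
  have hw0 : w ≠ 0 := by rintro rfl; simp at hw
  have hcw0 : (starRingEnd ℂ) w ≠ 0 := by simpa using hw0
  intro h
  obtain ⟨hre, him⟩ := Complex.arg_eq_pi_iff.mp h
  set r := w / (starRingEnd ℂ) w with hr
  have hw' : w = r * (starRingEnd ℂ) w := by rw [hr]; field_simp
  have := congrArg Complex.re hw'
  simp [him] at this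
  nlinarith

/-- Principal square roots avoid the branch cut. -/
lemma cpow_inv_two_arg_ne_pi (z : ℂ) : (z ^ ((2 : ℂ)⁻¹)).arg ≠ Real.pi := by
  intro h
  have hre := (Complex.arg_eq_pi_iff.mp h).1
  rw [Complex.cpow_inv_two_re] at hre
  exact hre.not_ge (Real.sqrt_nonneg _)

lemma sqb_neg {α β : ℝ} (hα : 0 ≤ α) (hα1 : α < 1) (hβ : 0 ≤ β) (hβ1 : β < 1) (θ : ℝ) :
    sqb α β (-θ) = (sqb α β θ)⁻¹ := by
  obtain ⟨w, hw, h1, h2⟩ := exists_bfun_eq hα hα1 hβ hβ1 θ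
  rw [sqb, sqb, h1, h2, ← inv_div w, Complex.inv_cpow _ _ (div_conj_arg_ne_pi hw),
    Complex.inv_cpow _ _ (cpow_inv_two_arg_ne_pi _)]

lemma conj_sqb {α β : ℝ} (hα : 0 ≤ α) (hα1 : α < 1) (hβ : 0 ≤ β) (hβ1 : β < 1) (θ : ℝ) :
    (starRingEnd ℂ) (sqb α β θ) = sqb α β (-θ) := by
  obtain ⟨w, hw, h1, h2⟩ := exists_bfun_eq hα hα1 hβ hβ1 θ
  have hr : (starRingEnd ℂ) w / w = (starRingEnd ℂ) (w / (starRingEnd ℂ) w) := by simp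
  have h2' : (starRingEnd ℂ) ((2 : ℂ)⁻¹) = (2 : ℂ)⁻¹ := by
    rw [map_inv₀, Complex.conj_ofNat]
  rw [sqb, sqb, h1, h2, hr, Complex.conj_cpow _ _ (div_conj_arg_ne_pi hw), h2',
    Complex.conj_cpow _ _ (cpow_inv_two_arg_ne_pi _), h2']

lemma sqb_ne_zero {α β : ℝ} (hα : 0 ≤ α) (hα1 : α < 1) (hβ : 0 ≤ β) (hβ1 : β < 1) (θ : ℝ) :
    sqb α β θ ≠ 0 := by
  obtain ⟨w, hw, h1, -⟩ := exists_bfun_eq hα hα1 hβ hβ1 θ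
  have hw0 : w ≠ 0 := by rintro rfl; simp at hw
  simp [sqb, h1, Complex.cpow_eq_zero_iff, hw0]

lemma psiAnn_conjTranspose {N : ℕ} {α β : ℝ} (hα : 0 ≤ α) (hα1 : α < 1) (hβ : 0 ≤ β)
    (hβ1 : β < 1) (θ : ℝ) : (psiAnn α β θ : SpinOp N)ᴴ = psiDag α β θ := by
  simp only [psiAnn, psiDag, Matrix.conjTranspose_smul, Matrix.conjTranspose_add,
    pF_conjTranspose, qF_conjTranspose, Complex.star_def, map_mul, map_inv₀,
    conj_sqb hα hα1 hβ hβ1, ← Complex.exp_conj, Complex.conj_I, Complex.conj_ofReal, neg_neg,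
    Complex.conj_ofNat, neg_mul, neg_smul, sub_eq_add_neg]

lemma psiDag_conjTranspose {N : ℕ} {α β : ℝ} (hα : 0 ≤ α) (hα1 : α < 1) (hβ : 0 ≤ β)
    (hβ1 : β < 1) (θ : ℝ) : (psiDag α β θ : SpinOp N)ᴴ = psiAnn α β θ := by
  rw [← psiAnn_conjTranspose hα hα1 hβ hβ1, Matrix.conjTranspose_conjTranspose]

lemma thetaA_rev {N : ℕ} (k : Fin N) : thetaA N k.rev = -thetaA N k + 2 * Real.pi := by
  have hN : (N : ℝ) ≠ 0 := by exact_mod_cast (Fin.pos k).ne'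
  have h : ((k.rev : ℕ) : ℝ) = N - (k + 1) := by
    rw [Fin.val_rev, Nat.cast_sub k.isLt]; push_cast; ring
  rw [thetaA, thetaA, h]
  field_simp
  ring

lemma Dmat_eq_flipCoeff {N : ℕ} (m : ℕ) (α β : ℝ) (j k : Fin N) :
    Dmat N m α β j k = 2⁻¹ * flipCoeff N m j k *
      (sqb α β (thetaA N k) / sqb α β (thetaP N j) +
        sqb α β (thetaP N j) / sqb α β (thetaA N k)) := by
  have he : -Complex.I * ((m : ℂ) - 2⁻¹) * ((thetaP N j : ℝ) - (thetaA N k : ℝ)) =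
      Complex.I * ((m : ℂ) - 2⁻¹) * ((thetaA N k : ℝ) - (thetaP N j : ℝ)) := by ring
  simp only [Dmat, flipCoeff, Matrix.of_apply, Int.cast_natCast, he]
  congr 1
  rw [mul_assoc 2 Complex.I, mul_assoc 2, ← div_div, div_right_comm]
  ring

lemma Cmat_rev_eq_flipCoeff {N : ℕ} (m : ℕ) {α β : ℝ} (hα : 0 ≤ α) (hα1 : α < 1) (hβ : 0 ≤ β)
    (hβ1 : β < 1) (j k : Fin N) :
    Cmat N m α β j k.rev = 2⁻¹ * flipCoeff N m j k *
      (sqb α β (thetaA N k) / sqb α β (thetaP N j) -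
        sqb α β (thetaP N j) / sqb α β (thetaA N k)) := by
  have he : Complex.exp (-Complex.I * ((m : ℂ) - 2⁻¹) *
      ((thetaP N j : ℝ) + ((-thetaA N k + 2 * Real.pi : ℝ) : ℂ))) =
      -Complex.exp (Complex.I * ((m : ℂ) - 2⁻¹) * ((thetaA N k : ℝ) - (thetaP N j : ℝ))) := by
    rw [show -Complex.I * ((m : ℂ) - 2⁻¹) *
      ((thetaP N j : ℝ) + ((-thetaA N k + 2 * Real.pi : ℝ) : ℂ)) =
      Complex.I * ((m : ℂ) - 2⁻¹) * ((thetaA N k : ℝ) - (thetaP N j : ℝ)) +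
        ((-m : ℤ) * (2 * Real.pi * Complex.I) + Real.pi * Complex.I) by push_cast; ring,
      Complex.exp_add, Complex.exp_add, Complex.exp_int_mul_two_pi_mul_I, Complex.exp_pi_mul_I]
    ring
  have hs : Complex.sin (((thetaP N j : ℝ) + ((-thetaA N k + 2 * Real.pi : ℝ) : ℂ)) / 2) =
      Complex.sin ((((thetaA N k : ℝ) : ℂ) - (thetaP N j : ℝ)) / 2) := by
    rw [← Complex.sin_pi_sub]
    congr 1
    push_cast
    ring
  simp only [Cmat, flipCoeff, Matrix.of_apply, Int.cast_natCast, thetaA_rev, he, hs,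
    sqb_add_two_pi, sqb_neg hα hα1 hβ hβ1]
  have := sqb_ne_zero hα hα1 hβ hβ1 (thetaA N k)
  have := sqb_ne_zero hα hα1 hβ hβ1 (thetaP N j)
  have := sin_half_thetaA_sub_thetaP_ne_zero j k
  have hN : (N : ℂ) ≠ 0 := by exact_mod_cast (Fin.pos k).ne'
  have := Complex.I_ne_zero
  field_simp
  ring

lemma sOp_conj_psiAnn {N : ℕ} {α β : ℝ} (hα : 0 ≤ α) (hα1 : α < 1) (hβ : 0 ≤ β) (hβ1 : β < 1)
    (l j : Fin N) :
    sOp l * psiAnn α β (thetaP N j) * sOp l =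
      ∑ k : Fin N, (Cmat N (l : ℤ) α β j k • psiDag α β (thetaA N k) +
        Dmat N (l : ℤ) α β j k • psiAnn α β (thetaA N k)) := by
  rw [Finset.sum_add_distrib, ← Equiv.sum_comp Fin.revPerm, ← Finset.sum_add_distrib]
  simp only [psiAnn, mul_add, add_mul, mul_smul_comm, smul_mul_assoc, sOp_conj_pF, sOp_conj_qF,
    Finset.smul_sum, ← Finset.sum_add_distrib, Fin.revPerm_apply]
  refine Finset.sum_congr rfl fun k _ => ?_
  rw [Cmat_rev_eq_flipCoeff _ hα hα1 hβ hβ1, Dmat_eq_flipCoeff, thetaA_rev, psiDag_add_two_pi,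
    psiDag]
  simp only [sqb_neg hα hα1 hβ hβ1, neg_neg, Complex.ofReal_neg, neg_mul_neg]
  have hb := sqb_ne_zero hα hα1 hβ hβ1 (thetaA N k)
  have hb' := sqb_ne_zero hα hα1 hβ hβ1 (thetaP N j)
  have hshift := flipCoeff_succ_mul_exp l j k
  match_scalars
  · field_simp
    linear_combination 2 * sqb α β (thetaA N k) ^ 2 * hshift
  · field_simp
    ring

lemma tanh_mul_coth_lt_one {x y : ℝ} (hy : 0 < y) (hxy : x < y) :
    Real.tanh x * (Real.cosh y / Real.sinh y) < 1 := by
  have hs := Real.sinh_pos_iff.mpr hy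
  have h := Real.sinh_pos_iff.mpr (sub_pos.mpr hxy)
  rw [Real.sinh_sub] at h
  rw [Real.tanh_eq_sinh_div_cosh, div_mul_div_comm,
    div_lt_one (mul_pos (Real.cosh_pos x) hs)]
  linarith

/-- Conjugation of the periodic fermions φ†_θ, φ_θ (θ ∈ θ_p) by the spin
operator s_l, expressed through the antiperiodic fermions ψ†_{θ'}, ψ_{θ'}
(θ' ∈ θ_a) via the induced rotation matrix blocks A, B, C, D. -/
theorem spin_conjugation_fermions
    (N : ℕ) (hN : 1 ≤ N) (Kx Ky Kxs : ℝ)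
    (hKx : 0 < Kx) (hKy : 0 < Ky)
    (hKxs_pos : 0 < Kxs) (hKxs : Real.tanh Kxs = Real.exp (-(2 * Kx)))
    (α β : ℝ)
    (hα : α = Real.tanh Kxs * (Real.cosh Ky / Real.sinh Ky))
    (hβ : β = Real.tanh Kxs * Real.tanh Ky)
    (hferro : Kxs < Ky)
    (l : Fin N) (j : Fin N) :
    sOp l * psiDag α β (thetaP N j) * sOp l =
        ∑ k : Fin N,
          ((starRingEnd ℂ) (Dmat N (l : ℤ) α β j k) • psiDag α β (thetaA N k) +
            (starRingEnd ℂ) (Cmat N (l : ℤ) α β j k) • psiAnn α β (thetaA N k)) ∧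
      sOp l * psiAnn α β (thetaP N j) * sOp l =
        ∑ k : Fin N,
          (Cmat N (l : ℤ) α β j k • psiDag α β (thetaA N k) +
            Dmat N (l : ℤ) α β j k • psiAnn α β (thetaA N k)) := by
  have ht : 0 < Real.tanh Kxs := hKxs ▸ Real.exp_pos _
  have hty : 0 < Real.tanh Ky := by
    rw [Real.tanh_eq_sinh_div_cosh]
    exact div_pos (Real.sinh_pos_iff.mpr hKy) (Real.cosh_pos Ky)
  have hα0 : 0 ≤ α := by
    rw [hα]
    exact mul_nonneg ht.le (div_nonneg (Real.cosh_pos Ky).le (Real.sinh_pos_iff.mpr hKy).le)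
  have hα1 : α < 1 := hα ▸ tanh_mul_coth_lt_one hKy hferro
  have hβ0 : 0 ≤ β := hβ ▸ (mul_pos ht hty).le
  have hβ1 : β < 1 := by
    rw [hβ]
    nlinarith [Real.tanh_lt_one Kxs, Real.tanh_lt_one Ky]
  have h := sOp_conj_psiAnn hα0 hα1 hβ0 hβ1 l j
  refine ⟨?_, h⟩
  have h' := congrArg Matrix.conjTranspose h
  simpa only [Matrix.conjTranspose_mul, sOp_conjTranspose, Matrix.conjTranspose_sum,
    Matrix.conjTranspose_add, Matrix.conjTranspose_smul,
    psiAnn_conjTranspose hα0 hα1 hβ0 hβ1, psiDag_conjTranspose hα0 hα1 hβ0 hβ1,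
    Complex.star_def, mul_assoc, add_comm] using h'
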